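/- For any three roots δ₁, δ₂, δ₃ ∈ R that are pairwise orthogonal (B(δᵢ,δⱼ) = 0 for i ≠ j) and pairwise distinct up to sign (δᵢ ≠ ±δⱼ for i ≠ j), the number of orbits of the subgroup generated by the three reflections r_{δ₁}, r_{δ₂}, r_{δ₃} acting on the 72-element set R is exactly 25. (The 3A₁ row of Table 1: a cubic surface hyperplane section with three A₁ singularities has exactly 25 limiting primitive vanishing cycles.) -/

import Mathlib

/-- The intersection form on the lattice `I^{1,6} ≅ H²(S,ℤ)` of a smooth cubic surface. -/
def B (x y : Fin 7 → ℤ) : ℤ := x 0 * y 0 - ∑ i : Fin 6, x i.succ * y i.succ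

/-- The hyperplane class `h = 3e₀ - e₁ - ⋯ - e₆`. -/
def h : Fin 7 → ℤ := fun j => if j = 0 then 3 else -1

/-- The root system `R = {α : B(α,α) = -2, B(α,h) = 0}` (primitive vanishing cycles). -/
def R : Set (Fin 7 → ℤ) := {α | B α α = -2 ∧ B α h = 0}

/-- The reflection `r_α(β) = β + B(β,α)·α` in a root `α`. -/
def reflect (α β : Fin 7 → ℤ) : Fin 7 → ℤ := β + B β α • α

namespace Aux3A1

/-- Explicit expanded form of `B`. -/
def b (x y : Fin 7 → ℤ) : ℤ :=
  x 0 * y 0 - (x 1 * y 1 + x 2 * y 2 + x 3 * y 3 + x 4 * y 4 + x 5 * y 5 + x 6 * y 6)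

theorem B_eq (x y : Fin 7 → ℤ) : B x y = b x y := by
  simp [B, b, Fin.sum_univ_succ, Fin.succ]
  ring

theorem B_comm (x y : Fin 7 → ℤ) : B x y = B y x := by
  simp only [B_eq, b]; ring

theorem B_add (x y z : Fin 7 → ℤ) : B (x + y) z = B x z + B y z := by
  simp only [B_eq, b, Pi.add_apply]; ring

theorem B_smul (c : ℤ) (x z : Fin 7 → ℤ) : B (c • x) z = c * B x z := by
  simp only [B_eq, b, Pi.smul_apply, smul_eq_mul]; ring

theorem B_reflect_left (α x z : Fin 7 → ℤ) :
    B (reflect α x) z = B x z + B x α * B α z := by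
  rw [reflect, B_add, B_smul]

theorem B_reflect (α : Fin 7 → ℤ) (hα : α ∈ R) (x y : Fin 7 → ℤ) :
    B (reflect α x) (reflect α y) = B x y := by
  rw [B_reflect_left, B_comm x (reflect α y), B_comm α (reflect α y), B_reflect_left,
    B_reflect_left, hα.1, B_comm y x, B_comm α x]
  ring

theorem reflect_mem (α : Fin 7 → ℤ) (hα : α ∈ R) (x : Fin 7 → ℤ) (hx : x ∈ R) :
    reflect α x ∈ R := by
  refine ⟨by rw [B_reflect α hα]; exact hx.1, ?_⟩
  rw [B_reflect_left, hx.2, hα.2]; simp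

theorem reflect_reflect (α : Fin 7 → ℤ) (hα : α ∈ R) (x : Fin 7 → ℤ) :
    reflect α (reflect α x) = x := by
  have h1 : B (reflect α x) α = - B x α := by rw [B_reflect_left, hα.1]; ring
  rw [reflect, h1, reflect]
  simp

/-- Positive roots. -/
def pos : List (Fin 7 → ℤ) :=
  [![0, 0, 0, 0, 0, 1, -1],
   ![0, 0, 0, 0, 1, -1, 0],
   ![0, 0, 0, 0, 1, 0, -1],
   ![0, 0, 0, 1, -1, 0, 0],
   ![0, 0, 0, 1, 0, -1, 0],
   ![0, 0, 0, 1, 0, 0, -1],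
   ![0, 0, 1, -1, 0, 0, 0],
   ![0, 0, 1, 0, -1, 0, 0],
   ![0, 0, 1, 0, 0, -1, 0],
   ![0, 0, 1, 0, 0, 0, -1],
   ![0, 1, -1, 0, 0, 0, 0],
   ![0, 1, 0, -1, 0, 0, 0],
   ![0, 1, 0, 0, -1, 0, 0],
   ![0, 1, 0, 0, 0, -1, 0],
   ![0, 1, 0, 0, 0, 0, -1],
   ![1, -1, -1, -1, 0, 0, 0],
   ![1, -1, -1, 0, -1, 0, 0],
   ![1, -1, -1, 0, 0, -1, 0],
   ![1, -1, -1, 0, 0, 0, -1],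
   ![1, -1, 0, -1, -1, 0, 0],
   ![1, -1, 0, -1, 0, -1, 0],
   ![1, -1, 0, -1, 0, 0, -1],
   ![1, -1, 0, 0, -1, -1, 0],
   ![1, -1, 0, 0, -1, 0, -1],
   ![1, -1, 0, 0, 0, -1, -1],
   ![1, 0, -1, -1, -1, 0, 0],
   ![1, 0, -1, -1, 0, -1, 0],
   ![1, 0, -1, -1, 0, 0, -1],
   ![1, 0, -1, 0, -1, -1, 0],
   ![1, 0, -1, 0, -1, 0, -1],
   ![1, 0, -1, 0, 0, -1, -1],
   ![1, 0, 0, -1, -1, -1, 0],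
   ![1, 0, 0, -1, -1, 0, -1],
   ![1, 0, 0, -1, 0, -1, -1],
   ![1, 0, 0, 0, -1, -1, -1],
   ![2, -1, -1, -1, -1, -1, -1]]

/-- All the roots. -/
def roots : List (Fin 7 → ℤ) := pos ++ pos.map (fun x => -x)

theorem roots_nodup : roots.Nodup := by decide +kernel

theorem roots_sub : ∀ x ∈ roots, b x x = -2 ∧ b x ![3, -1, -1, -1, -1, -1, -1] = 0 := by
  decide +kernel

theorem h_eq : h = ![3, -1, -1, -1, -1, -1, -1] := by decide

theorem enum : ∀ x0 ∈ [-2, -1, 0, 1, (2 : ℤ)], ∀ x1 ∈ [-1, 0, (1 : ℤ)], ∀ x2 ∈ [-1, 0, (1 : ℤ)],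
    ∀ x3 ∈ [-1, 0, (1 : ℤ)], ∀ x4 ∈ [-1, 0, (1 : ℤ)], ∀ x5 ∈ [-1, 0, (1 : ℤ)],
    ∀ x6 ∈ [-1, 0, (1 : ℤ)],
    3 * x0 + (x1 + x2 + x3 + x4 + x5 + x6) = 0 →
    x0 * x0 - (x1 * x1 + x2 * x2 + x3 * x3 + x4 * x4 + x5 * x5 + x6 * x6) = -2 →
    ![x0, x1, x2, x3, x4, x5, x6] ∈ roots := by
  decide +kernel

theorem small (a : ℤ) (ha : a ^ 2 < 4) : a ∈ [-1, 0, (1 : ℤ)] := by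
  have h1 : a < 2 := by nlinarith
  have h2 : -2 < a := by nlinarith
  have : a = -1 ∨ a = 0 ∨ a = 1 := by omega
  simpa using this

/-- The coordinate bound, from Cauchy–Schwarz in the other five coordinates. -/
theorem bound (a b c d e f x : ℤ) (hs : 3 * x + (a + b + c + d + e + f) = 0)
    (hq : x * x - (a * a + b * b + c * c + d * d + e * e + f * f) = -2) : a ^ 2 < 4 := by
  have hb : b + c + d + e + f = -3 * x - a := by linarith
  have hcs : (b + c + d + e + f) ^ 2 ≤ 5 * (b ^ 2 + c ^ 2 + d ^ 2 + e ^ 2 + f ^ 2) := by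
    nlinarith [sq_nonneg (b - c), sq_nonneg (b - d), sq_nonneg (b - e), sq_nonneg (b - f),
      sq_nonneg (c - d), sq_nonneg (c - e), sq_nonneg (c - f), sq_nonneg (d - e),
      sq_nonneg (d - f), sq_nonneg (e - f)]
  rw [hb] at hcs
  -- 4 x^2 + 6 a x + 6 a^2 ≤ 10
  nlinarith [sq_nonneg (4 * x + 3 * a)]

theorem mem_roots (x : Fin 7 → ℤ) : x ∈ R ↔ x ∈ roots := by
  constructor
  · rintro ⟨hq, hs⟩
    rw [B_eq, b] at hq
    rw [h_eq, B_eq, b] at hs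
    have hs' : 3 * x 0 + (x 1 + x 2 + x 3 + x 4 + x 5 + x 6) = 0 := by
      simp at hs; linarith
    have hx : x = ![x 0, x 1, x 2, x 3, x 4, x 5, x 6] := by
      ext i; fin_cases i <;> rfl
    have h0 : x 0 ∈ [-2, -1, 0, 1, (2 : ℤ)] := by
      have hcs : (x 1 + x 2 + x 3 + x 4 + x 5 + x 6) ^ 2 ≤
          6 * (x 1 ^ 2 + x 2 ^ 2 + x 3 ^ 2 + x 4 ^ 2 + x 5 ^ 2 + x 6 ^ 2) := by
        have := Finset.sum_mul_sq_le_sq_mul_sq Finset.univ (fun _ : Fin 6 => (1 : ℤ))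
          (fun i => x i.succ)
        simp [Fin.sum_univ_succ, Fin.succ] at this
        linarith
      have h4 : (x 0) ^ 2 ≤ 4 := by
        have : x 1 + x 2 + x 3 + x 4 + x 5 + x 6 = -3 * x 0 := by linarith
        rw [this] at hcs
        nlinarith
      have h1 : x 0 < 3 := by nlinarith
      have h2 : -3 < x 0 := by nlinarith
      have : x 0 = -2 ∨ x 0 = -1 ∨ x 0 = 0 ∨ x 0 = 1 ∨ x 0 = 2 := by omega
      simpa using this
    rw [hx]
    refine enum _ h0 _ (small _ ?_) _ (small _ ?_) _ (small _ ?_) _ (small _ ?_) _ (small _ ?_)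
      _ (small _ ?_) hs' hq
    · exact bound (x 1) (x 2) (x 3) (x 4) (x 5) (x 6) (x 0) (by linarith) (by linarith)
    · exact bound (x 2) (x 1) (x 3) (x 4) (x 5) (x 6) (x 0) (by linarith) (by linarith)
    · exact bound (x 3) (x 2) (x 1) (x 4) (x 5) (x 6) (x 0) (by linarith) (by linarith)
    · exact bound (x 4) (x 2) (x 3) (x 1) (x 5) (x 6) (x 0) (by linarith) (by linarith)
    · exact bound (x 5) (x 2) (x 3) (x 4) (x 1) (x 6) (x 0) (by linarith) (by linarith)
    · exact bound (x 6) (x 2) (x 3) (x 4) (x 5) (x 1) (x 0) (by linarith) (by linarith)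
  · intro hx
    have := roots_sub x hx
    exact ⟨by rw [B_eq]; exact this.1, by rw [B_eq, h_eq]; exact this.2⟩

/-- The base root `e₁ - e₂`. -/
def base : Fin 7 → ℤ := ![0, 1, -1, 0, 0, 0, 0]

/-- The reflection written with `b`. -/
def refl' (α β : Fin 7 → ℤ) : Fin 7 → ℤ := fun i => β i + b β α * α i

theorem reflect_eq (α β : Fin 7 → ℤ) : reflect α β = refl' α β := by
  ext i; simp [reflect, refl', B_eq]

theorem trans' : ∀ x ∈ roots, ∃ s ∈ roots, ∃ t ∈ roots, refl' t (refl' s x) = base := by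
  decide +kernel

theorem count_base : ∀ y ∈ roots.filter (fun y => b base y = 0),
    ∀ z ∈ (roots.filter (fun y => b base y = 0)).filter (fun z => b y z = 0),
    (((roots.filter (fun w => 0 ≤ b w base)).filter (fun w => 0 ≤ b w y)).filter
      (fun w => 0 ≤ b w z)).length = 25 := by
  decide +kernel

/-- The dominant roots, a fundamental domain. -/
def dom (x y z : Fin 7 → ℤ) : Set (Fin 7 → ℤ) :=
  {w | w ∈ R ∧ 0 ≤ B w x ∧ 0 ≤ B w y ∧ 0 ≤ B w z}

theorem dom_reflect (α x y z : Fin 7 → ℤ) (hα : α ∈ R) :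
    (dom (reflect α x) (reflect α y) (reflect α z)).ncard = (dom x y z).ncard := by
  have hi : Function.Injective (reflect α) :=
    Function.LeftInverse.injective (reflect_reflect α hα)
  rw [← Set.ncard_image_of_injective (dom x y z) hi]
  congr 1
  ext w
  constructor
  · rintro ⟨h0, h1, h2, h3⟩
    refine ⟨reflect α w, ⟨reflect_mem α hα w h0, ?_, ?_, ?_⟩, reflect_reflect α hα w⟩
    · rw [← B_reflect α hα, reflect_reflect α hα]; exact h1
    · rw [← B_reflect α hα, reflect_reflect α hα]; exact h2
    · rw [← B_reflect α hα, reflect_reflect α hα]; exact h3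
  · rintro ⟨v, ⟨h0, h1, h2, h3⟩, rfl⟩
    refine ⟨reflect_mem α hα v h0, ?_, ?_, ?_⟩ <;> rw [B_reflect α hα] <;> assumption

theorem dom_base (y z : Fin 7 → ℤ) (hy : y ∈ R) (hz : z ∈ R) (h1 : B base y = 0)
    (h2 : B base z = 0) (h3 : B y z = 0) : (dom base y z).ncard = 25 := by
  rw [mem_roots] at hy hz
  rw [B_eq] at h1 h2 h3
  have hc := count_base y (by simp [hy, h1]) z (by simp [hz, h2, h3])
  have he : dom base y z = ((((roots.filter (fun w => 0 ≤ b w base)).filter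
      (fun w => 0 ≤ b w y)).filter (fun w => 0 ≤ b w z)).toFinset : Set (Fin 7 → ℤ)) := by
    ext w
    simp [dom, mem_roots, B_eq]
    tauto
  rw [he, Set.ncard_coe_finset, List.toFinset_card_of_nodup, hc]
  exact ((roots_nodup.filter _).filter _).filter _

theorem dom_card (x y z : Fin 7 → ℤ) (hx : x ∈ R) (hy : y ∈ R) (hz : z ∈ R) (h1 : B x y = 0)
    (h2 : B x z = 0) (h3 : B y z = 0) : (dom x y z).ncard = 25 := by
  obtain ⟨s, hs, t, ht, hst⟩ := trans' x ((mem_roots x).1 hx)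
  rw [← mem_roots] at hs ht
  rw [← reflect_eq, ← reflect_eq] at hst
  rw [← dom_reflect s _ _ _ hs, ← dom_reflect t _ _ _ ht, hst]
  apply dom_base
  · exact reflect_mem t ht _ (reflect_mem s hs _ hy)
  · exact reflect_mem t ht _ (reflect_mem s hs _ hz)
  · rw [← hst, B_reflect t ht, B_reflect s hs, h1]
  · rw [← hst, B_reflect t ht, B_reflect s hs, h2]
  · rw [B_reflect t ht, B_reflect s hs, h3]

/-- A reflection or the identity makes the pairing nonnegative. -/
theorem make_nonneg (G : Subgroup (Equiv.Perm (Fin 7 → ℤ))) (δ : Fin 7 → ℤ) (hδ : δ ∈ R)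
    (g : Equiv.Perm (Fin 7 → ℤ)) (hg : ∀ β, g β = reflect δ β) (hG : g ∈ G) (β : Fin 7 → ℤ)
    (hβ : β ∈ R) : ∃ γ ∈ R, γ ∈ MulAction.orbit G β ∧ 0 ≤ B γ δ ∧
      ∀ ε, B δ ε = 0 → B γ ε = B β ε := by
  by_cases hn : 0 ≤ B β δ
  · exact ⟨β, hβ, MulAction.mem_orbit_self β, hn, fun _ _ => rfl⟩
  · refine ⟨reflect δ β, reflect_mem δ hδ β hβ, ⟨⟨g, hG⟩, hg β⟩, ?_, ?_⟩
    · rw [B_reflect_left, hδ.1]; linarith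
    · intro ε hε; rw [B_reflect_left, hε]; ring

/-- The orbit invariant. -/
def inv (x y z w : Fin 7 → ℤ) : (Fin 7 → ℤ) × ℤ × ℤ × ℤ :=
  ((2 : ℤ) • w + B w x • x + B w y • y + B w z • z, |B w x|, |B w y|, |B w z|)

theorem inv_reflect1 (x y z w : Fin 7 → ℤ) (hx : x ∈ R) (h1 : B x y = 0) (h2 : B x z = 0) :
    inv x y z (reflect x w) = inv x y z w := by
  have e : B w x + B w x * -2 = - B w x := by ring
  simp only [inv, B_reflect_left, h1, h2, hx.1, mul_zero, add_zero, e, abs_neg]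
  congr 1
  rw [reflect]
  module

theorem inv_reflect2 (x y z w : Fin 7 → ℤ) (hy : y ∈ R) (h1 : B y x = 0) (h2 : B y z = 0) :
    inv x y z (reflect y w) = inv x y z w := by
  have e : B w y + B w y * -2 = - B w y := by ring
  simp only [inv, B_reflect_left, h1, h2, hy.1, mul_zero, add_zero, e, abs_neg]
  congr 1
  rw [reflect]
  module

theorem inv_reflect3 (x y z w : Fin 7 → ℤ) (hz : z ∈ R) (h1 : B z x = 0) (h2 : B z y = 0) :
    inv x y z (reflect z w) = inv x y z w := by
  have e : B w z + B w z * -2 = - B w z := by ring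
  simp only [inv, B_reflect_left, h1, h2, hz.1, mul_zero, add_zero, e, abs_neg]
  congr 1
  rw [reflect]
  module

theorem inv_inj (x y z v w : Fin 7 → ℤ) (hv : v ∈ dom x y z) (hw : w ∈ dom x y z)
    (he : inv x y z v = inv x y z w) : v = w := by
  obtain ⟨-, v1, v2, v3⟩ := hv
  obtain ⟨-, w1, w2, w3⟩ := hw
  simp only [inv, Prod.mk.injEq] at he
  obtain ⟨e, e1, e2, e3⟩ := he
  rw [abs_of_nonneg v1, abs_of_nonneg w1] at e1
  rw [abs_of_nonneg v2, abs_of_nonneg w2] at e2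
  rw [abs_of_nonneg v3, abs_of_nonneg w3] at e3
  rw [e1, e2, e3] at e
  ext i
  have := congrFun e i
  simp at this
  exact this

end Aux3A1

open Aux3A1 in
/-- For three pairwise orthogonal roots, pairwise distinct up to sign (type `3A₁`), the
subgroup generated by the three reflections has exactly 25 orbits on the 72 roots. -/
theorem orbits_3A1 (δ₁ δ₂ δ₃ : Fin 7 → ℤ) (h₁ : δ₁ ∈ R) (h₂ : δ₂ ∈ R) (h₃ : δ₃ ∈ R)
    (h12 : B δ₁ δ₂ = 0) (h13 : B δ₁ δ₃ = 0) (h23 : B δ₂ δ₃ = 0)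
    (hne12 : δ₁ ≠ δ₂ ∧ δ₁ ≠ -δ₂) (hne13 : δ₁ ≠ δ₃ ∧ δ₁ ≠ -δ₃) (hne23 : δ₂ ≠ δ₃ ∧ δ₂ ≠ -δ₃)
    (g₁ g₂ g₃ : Equiv.Perm (Fin 7 → ℤ))
    (hg₁ : ∀ β, g₁ β = reflect δ₁ β) (hg₂ : ∀ β, g₂ β = reflect δ₂ β)
    (hg₃ : ∀ β, g₃ β = reflect δ₃ β) :
    {O : Set (Fin 7 → ℤ) | ∃ β ∈ R,
      O = MulAction.orbit
        (Subgroup.closure {g₁, g₂, g₃} : Subgroup (Equiv.Perm (Fin 7 → ℤ))) β}.ncard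
      = 25 := by
  have h21 : B δ₂ δ₁ = 0 := by rw [B_comm]; exact h12
  have h31 : B δ₃ δ₁ = 0 := by rw [B_comm]; exact h13
  have h32 : B δ₃ δ₂ = 0 := by rw [B_comm]; exact h23
  set G : Subgroup (Equiv.Perm (Fin 7 → ℤ)) := Subgroup.closure {g₁, g₂, g₃} with hG
  have m1 : g₁ ∈ G := Subgroup.subset_closure (by simp)
  have m2 : g₂ ∈ G := Subgroup.subset_closure (by simp)
  have m3 : g₃ ∈ G := Subgroup.subset_closure (by simp)
  have hinv : ∀ g ∈ G, ∀ w, inv δ₁ δ₂ δ₃ (g w) = inv δ₁ δ₂ δ₃ w := by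
    intro g hg
    refine Subgroup.closure_induction (p := fun g _ => ∀ w, inv δ₁ δ₂ δ₃ (g w) = inv δ₁ δ₂ δ₃ w)
      ?_ ?_ ?_ ?_ hg
    · intro k hk w
      simp only [Set.mem_insert_iff, Set.mem_singleton_iff] at hk
      rcases hk with rfl | rfl | rfl
      · rw [hg₁]; exact inv_reflect1 _ _ _ _ h₁ h12 h13
      · rw [hg₂]; exact inv_reflect2 _ _ _ _ h₂ h21 h23
      · rw [hg₃]; exact inv_reflect3 _ _ _ _ h₃ h31 h32
    · intro w; rfl
    · intro a c _ _ ha hc w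
      rw [Equiv.Perm.mul_apply, ha, hc]
    · intro a _ ha w
      have e : a (a⁻¹ w) = w := a.apply_symm_apply w
      rw [← ha (a⁻¹ w), e]
  rw [← dom_card δ₁ δ₂ δ₃ h₁ h₂ h₃ h12 h13 h23]
  have himg : {O : Set (Fin 7 → ℤ) | ∃ β ∈ R, O = MulAction.orbit G β}
      = Set.image (fun β => MulAction.orbit G β) (dom δ₁ δ₂ δ₃) := by
    ext O
    constructor
    · rintro ⟨β, hβ, rfl⟩
      obtain ⟨β1, r1, o1, p1, q1⟩ := make_nonneg G δ₁ h₁ g₁ hg₁ m1 β hβ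
      obtain ⟨β2, r2, o2, p2, q2⟩ := make_nonneg G δ₂ h₂ g₂ hg₂ m2 β1 r1
      obtain ⟨β3, r3, o3, p3, q3⟩ := make_nonneg G δ₃ h₃ g₃ hg₃ m3 β2 r2
      refine ⟨β3, ⟨r3, ?_, ?_, p3⟩, ?_⟩
      · rw [q3 _ h31, q2 _ h21]; exact p1
      · rw [q3 _ h32]; exact p2
      · change MulAction.orbit G β3 = MulAction.orbit G β
        rw [MulAction.orbit_eq_iff.2 o3, MulAction.orbit_eq_iff.2 o2, MulAction.orbit_eq_iff.2 o1]
    · rintro ⟨β, hβ, rfl⟩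
      exact ⟨β, hβ.1, rfl⟩
  rw [himg]
  apply Set.InjOn.ncard_image
  intro v hv w hw he
  obtain ⟨⟨g, hg⟩, hgw⟩ := MulAction.orbit_eq_iff.1 he
  apply inv_inj _ _ _ _ _ hv hw
  rw [← hgw]
  exact hinv g hg w
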